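/- Consider a phase of the algorithm TC and fix any time t > begin(P). For every valid changeset X' for C_t it holds that cnt_t(X') ≤ |X'|·α. Moreover, if TC applies a changeset X at time t, then: (1) X contains the node requested at round t; (2) cnt_t(X) = |X|·α; (3) cnt_t(Y) < |Y|·α for every valid changeset Y for C_{t+1}, where C_{t+1} is the cache state right after the application of X. -/

import Mathlib

open scoped Classical

/-!
Common setup for the online tree caching problem
(Bienkowski, Marcinkowski, Pacut, Schmid, Spyra, "Online Tree Caching").
-/

/-- A finite rooted tree on the vertex type `V`: every vertex has a parent,
the root is its own parent, and iterating `parent` from any vertex reaches the root. -/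
structure RTree (V : Type) where
  root : V
  parent : V → V
  parent_root : parent root = root
  reaches_root : ∀ v : V, ∃ n : ℕ, parent^[n] v = root

namespace RTree

variable {V : Type}

/-- The subtree `T(u)`: `u` together with all its descendants. -/
def subtree (T : RTree V) (u : V) : Set V :=
  {v | ∃ n : ℕ, T.parent^[n] v = u}

/-- `C` is a subforest of `T`: with every node it contains the whole subtree below it. -/
def Subforest (T : RTree V) (C : Set V) : Prop :=
  ∀ v ∈ C, T.subtree v ⊆ C

/-- `A` is a tree cap rooted at `v`: `A ⊆ T(v)`, `v ∈ A`, and `A` is closed under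
taking the parent (towards `v`). -/
def TreeCap (T : RTree V) (v : V) (A : Set V) : Prop :=
  A ⊆ T.subtree v ∧ v ∈ A ∧ ∀ u ∈ A, u ≠ v → T.parent u ∈ A

/-- `X` is a valid positive changeset for the cache `C`. -/
def ValidPos (T : RTree V) (C X : Set V) : Prop :=
  X.Nonempty ∧ X ∩ C = ∅ ∧ T.Subforest (C ∪ X)

/-- `X` is a valid negative changeset for the cache `C`. -/
def ValidNeg (T : RTree V) (C X : Set V) : Prop :=
  X.Nonempty ∧ X ⊆ C ∧ T.Subforest (C \ X)

/-- `X` is a valid changeset for the cache `C`. -/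
def Valid (T : RTree V) (C X : Set V) : Prop :=
  T.ValidPos C X ∨ T.ValidNeg C X

/-- `w` is the root of a tree (connected component) of the subforest `C`. -/
def IsCompRoot (T : RTree V) (C : Set V) (w : V) : Prop :=
  w ∈ C ∧ (w = T.root ∨ T.parent w ∉ C)

/-- The depth of a node: its distance to the root. -/
noncomputable def depth [DecidableEq V] (T : RTree V) (v : V) : ℕ :=
  Nat.find (T.reaches_root v)

/-- The height `h(T)` of the tree: its number of levels. -/
noncomputable def height [Fintype V] [DecidableEq V] (T : RTree V) : ℕ :=
  (Finset.univ.sup fun v => T.depth v) + 1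

end RTree

/-- A request: a node together with a sign (`true` = positive, `false` = negative). -/
abbrev Request (V : Type) := V × Bool

/-- The request `r` incurs cost `1` when the cache is `C`
(a positive request to a non-cached node, or a negative request to a cached node). -/
def Costly {V : Type} (r : Request V) (C : Set V) : Prop :=
  (r.2 = true ∧ r.1 ∉ C) ∨ (r.2 = false ∧ r.1 ∈ C)

/-- The sum of the counters `f` over the set of nodes `A`. -/
noncomputable def cntSum {V : Type} [Fintype V] (f : V → ℕ) (A : Set V) : ℕ :=
  ∑ v : V, A.indicator f v

/-- The number of nodes of a changeset (`0` for no changeset). -/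
noncomputable def chgSize {V : Type} : Option (Set V) → ℕ
  | none => 0
  | some X => X.ncard

/-- One phase of the algorithm `TC` on the request sequence `req` (the request of
round `t ≥ 1` is `req t`), starting at time `0` with an empty cache.
`cache t` is the cache contents during round `t`; `cnt t` are the counter values just
after serving the request of round `t` (used for the decision at time `t`);
`chg t` is the changeset applied at time `t` (right after round `t`), if any. -/
structure TCPhase {V : Type} [Fintype V] [DecidableEq V]
    (T : RTree V) (α : ℕ) (req : ℕ → Request V) where
  cache : ℕ → Set V
  cnt : ℕ → V → ℕ
  chg : ℕ → Option (Set V)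
  cache_subforest : ∀ t, T.Subforest (cache t)
  cache_zero : cache 0 = ∅
  cnt_zero : ∀ v, cnt 0 v = 0
  cnt_rec : ∀ t v, cnt (t + 1) v =
    (if ∃ X, chg t = some X ∧ v ∈ X then 0 else cnt t v)
    + (if (req (t + 1)).1 = v ∧ Costly (req (t + 1)) (cache (t + 1)) then 1 else 0)
  step_some : ∀ t X, chg t = some X →
    T.Valid (cache t) X ∧
    X.ncard * α ≤ cntSum (cnt t) X ∧
    (∀ Y, T.Valid (cache t) Y → X ⊂ Y → cntSum (cnt t) Y < Y.ncard * α) ∧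
    cache (t + 1) = if T.ValidPos (cache t) X then cache t ∪ X else cache t \ X
  step_none : ∀ t, chg t = none →
    cache (t + 1) = cache t ∧
    ∀ X, T.Valid (cache t) X → cntSum (cnt t) X < X.ncard * α

namespace TCPhase

variable {V : Type} [Fintype V] [DecidableEq V]
  {T : RTree V} {α : ℕ} {req : ℕ → Request V}

/-- The counter values at time `t`, right after the cache change at time `t`
(counters of fetched/evicted nodes are reset to `0`). -/
noncomputable def cntPost (E : TCPhase T α req) (t : ℕ) (v : V) : ℕ :=
  if ∃ X, E.chg t = some X ∧ v ∈ X then 0 else E.cnt t v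

/-- `last_v(t)`: the last time strictly before `t` at which `v` changed its
cached/non-cached state (`0`, the beginning of the phase, if there is none). -/
noncomputable def lastChg (E : TCPhase T α req) (v : V) (t : ℕ) : ℕ :=
  ((Finset.range t).filter fun s => ¬ ((v ∈ E.cache s) ↔ v ∈ E.cache (s + 1))).sup id

/-- The slot `(v, r)` belongs to the field `F^t`. -/
def inField (E : TCPhase T α req) (t : ℕ) (v : V) (r : ℕ) : Prop :=
  ∃ X, E.chg t = some X ∧ v ∈ X ∧ E.lastChg v t < r ∧ r ≤ t

/-- The number of requests of the sequence `ρ` lying in slots of `F^t_{≤ τ} ∩ D`. -/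
noncomputable def fieldReqIn (E : TCPhase T α req) (ρ : ℕ → Request V)
    (t : ℕ) (D : Set V) (τ : ℕ) : ℕ :=
  ((Finset.Icc 1 t).filter fun r => r ≤ τ ∧ (ρ r).1 ∈ D ∧ E.inField t (ρ r).1 r).card

/-- `req(F^t)`: the number of requests of `ρ` in slots of the field `F^t`. -/
noncomputable def fieldReq (E : TCPhase T α req) (ρ : ℕ → Request V) (t : ℕ) : ℕ :=
  E.fieldReqIn ρ t Set.univ t

/-- `size(F^t_{≤ τ} ∩ D)`: the number of distinct nodes having a slot in `F^t_{≤ τ} ∩ D`. -/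
noncomputable def fieldSizeIn (E : TCPhase T α req) (t : ℕ) (D : Set V) (τ : ℕ) : ℕ :=
  (Finset.univ.filter fun v : V => v ∈ D ∧ ∃ r, r ≤ τ ∧ E.inField t v r).card

/-- The standing assumption: no positive requests are given to cached nodes and no
negative requests to non-cached ones (so every request incurs cost `1` for `TC`). -/
def GoodReq (E : TCPhase T α req) : Prop :=
  ∀ t, 1 ≤ t →
    ((req t).2 = true → (req t).1 ∉ E.cache t) ∧
    ((req t).2 = false → (req t).1 ∈ E.cache t)

/-- The phase consists of rounds `1, …, tEnd`: no cache of `TC` before time `tEnd`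
exceeds the capacity `kONL` (at time `tEnd` the triggered fetch, if any, is performed
even if it exceeds the capacity, and is followed by the final eviction). -/
def PhaseEnd (E : TCPhase T α req) (kONL tEnd : ℕ) : Prop :=
  ∀ t, t < tEnd → (E.cache (t + 1)).ncard ≤ kONL

/-- `k_P`: the number of nodes in `TC`'s cache at the end of the phase
(after the fetch at time `tEnd`, before the final eviction). -/
noncomputable def kP (E : TCPhase T α req) (tEnd : ℕ) : ℕ :=
  (E.cache (tEnd + 1)).ncard

/-- The phase ending at `tEnd` is finished: the fetch at time `tEnd` exceeded the
capacity `kONL`. -/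
def FinishedAt (E : TCPhase T α req) (kONL tEnd : ℕ) : Prop :=
  E.PhaseEnd kONL tEnd ∧ kONL < E.kP tEnd

/-- `size(𝓕)`: the total size of all fields of the phase. -/
noncomputable def sizeFields (E : TCPhase T α req) (tEnd : ℕ) : ℕ :=
  ∑ t ∈ Finset.Icc 1 tEnd, chgSize (E.chg t)

/-- `req(F^∞)`: the number of requests of the phase lying in slots of the open field
(slots covered by no field of the phase). -/
noncomputable def openReq (E : TCPhase T α req) (tEnd : ℕ) : ℕ :=
  ((Finset.Icc 1 tEnd).filter fun r => ∀ t, t ≤ tEnd → ¬ E.inField t (req r).1 r).card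

/-- `TC(P)`: the total cost paid by `TC` during the phase: serving the requests,
fetching/evicting the applied changesets (`α` per node), and the final eviction
(`α · k_P`) if the phase is finished. -/
noncomputable def tcCost (E : TCPhase T α req) (kONL tEnd : ℕ) : ℕ :=
  ((Finset.Icc 1 tEnd).filter fun r => Costly (req r) (E.cache r)).card
  + α * E.sizeFields tEnd
  + (if kONL < E.kP tEnd then α * E.kP tEnd else 0)

/-- The tree cap `Y` (rooted at `u`, inside the negative field `F^t`) is proper for
the request sequence `ρ`: it holds `req(F^t ∩ Y) = |Y| · α`, and `F^t_{≤ τ} ∩ D` is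
not over-requested for every tree cap `D ⊆ Y` rooted at `u` and every time `τ ≤ t`. -/
def Proper (E : TCPhase T α req) (ρ : ℕ → Request V) (t : ℕ) (u : V) (Y : Set V) : Prop :=
  E.fieldReqIn ρ t Y t = Y.ncard * α ∧
  ∀ (D : Set V) (τ : ℕ), T.TreeCap u D → D ⊆ Y → τ ≤ t →
    E.fieldReqIn ρ t D τ ≤ E.fieldSizeIn t D τ * α

end TCPhase

/-- `D` is a feasible cache schedule for an (offline) algorithm with cache size `k`:
at every time the cache is a subforest of `T` of at most `k` nodes. -/
def IsSchedule {V : Type} (T : RTree V) (k : ℕ) (D : ℕ → Set V) : Prop :=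
  ∀ t, T.Subforest (D t) ∧ (D t).ncard ≤ k

/-- The cost of serving the requests of rounds `a, …, b` of `ρ` when the cache during
round `r` is `D r`. -/
noncomputable def serveCost {V : Type} (ρ : ℕ → Request V) (D : ℕ → Set V) (a b : ℕ) : ℕ :=
  ((Finset.Icc a b).filter fun r => Costly (ρ r) (D r)).card

/-- The reorganization cost of the schedule `D` (`α` per fetched or evicted node) over
the times `a, …, b - 1` (the change at time `t` leads from `D t` to `D (t+1)`). -/
noncomputable def moveCost {V : Type} (α : ℕ) (D : ℕ → Set V) (a b : ℕ) : ℕ :=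
  α * ∑ t ∈ Finset.Ico a b, ((D (t + 1) \ D t).ncard + (D t \ D (t + 1)).ncard)

/-- `OPT`: the minimum cost of serving rounds `a, …, b` of `ρ` by an offline algorithm
with cache size `k` that may start with an arbitrary cache. -/
noncomputable def optCostFrom {V : Type} (T : RTree V) (α k : ℕ)
    (ρ : ℕ → Request V) (a b : ℕ) : ℕ :=
  sInf {n | ∃ D : ℕ → Set V, IsSchedule T k D ∧
    n = serveCost ρ D a b + moveCost α D a b}

/-- `OPT`: the minimum cost of serving rounds `1, …, b` of `ρ` by an offline algorithm
with cache size `k` that starts with the empty cache. -/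
noncomputable def optCostEmpty {V : Type} (T : RTree V) (α k : ℕ)
    (ρ : ℕ → Request V) (b : ℕ) : ℕ :=
  sInf {n | ∃ D : ℕ → Set V, IsSchedule T k D ∧ D 0 = ∅ ∧
    n = serveCost ρ D 1 b + moveCost α D 0 b}

/-- `ρ'` is obtained from `ρ` by legally shifting requests: signs are preserved, every
positive request is moved to a descendant of its node (or kept), and every negative
request is moved to an ancestor of its node (or kept). -/
def LegalShift {V : Type} (T : RTree V) (ρ ρ' : ℕ → Request V) : Prop :=
  ∀ t, (ρ' t).2 = (ρ t).2 ∧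
    ((ρ t).2 = true → (ρ' t).1 ∈ T.subtree (ρ t).1) ∧
    ((ρ t).2 = false → (ρ t).1 ∈ T.subtree (ρ' t).1)

/-- A full run of the algorithm `TC` with cache capacity `kONL` on the request
sequence `req`, including phase restarts: whenever the fetch of a saturated changeset
would exceed the capacity, `TC` instead evicts its whole cache and a new phase starts
(`newPhase t` holds, and all counters are reset). -/
structure TCRun {V : Type} [Fintype V] [DecidableEq V]
    (T : RTree V) (α kONL : ℕ) (req : ℕ → Request V) where
  cache : ℕ → Set V
  cnt : ℕ → V → ℕ
  chg : ℕ → Option (Set V)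
  newPhase : ℕ → Prop
  cache_subforest : ∀ t, T.Subforest (cache t)
  cache_zero : cache 0 = ∅
  cnt_zero : ∀ v, cnt 0 v = 0
  capacity : ∀ t, (cache t).ncard ≤ kONL
  cnt_rec : ∀ t v, cnt (t + 1) v =
    (if newPhase t ∨ ∃ X, chg t = some X ∧ v ∈ X then 0 else cnt t v)
    + (if (req (t + 1)).1 = v ∧ Costly (req (t + 1)) (cache (t + 1)) then 1 else 0)
  step_some : ∀ t X, chg t = some X →
    T.Valid (cache t) X ∧
    X.ncard * α ≤ cntSum (cnt t) X ∧
    (∀ Y, T.Valid (cache t) Y → X ⊂ Y → cntSum (cnt t) Y < Y.ncard * α) ∧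
    ((T.ValidPos (cache t) X ∧ (cache t ∪ X).ncard ≤ kONL ∧
        cache (t + 1) = cache t ∪ X ∧ ¬ newPhase t) ∨
     (T.ValidPos (cache t) X ∧ kONL < (cache t ∪ X).ncard ∧
        cache (t + 1) = ∅ ∧ newPhase t) ∨
     (T.ValidNeg (cache t) X ∧ cache (t + 1) = cache t \ X ∧ ¬ newPhase t))
  step_none : ∀ t, chg t = none →
    cache (t + 1) = cache t ∧ ¬ newPhase t ∧
    ∀ X, T.Valid (cache t) X → cntSum (cnt t) X < X.ncard * α

/-- `TC(I)`: the total cost paid by the run `E` of `TC` on the rounds `1, …, N`: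
serving the requests, plus `α` per fetched/evicted node (on a phase restart the whole
cache is evicted). -/
noncomputable def TCRun.cost {V : Type} [Fintype V] [DecidableEq V]
    {T : RTree V} {α kONL : ℕ} {req : ℕ → Request V}
    (E : TCRun T α kONL req) (N : ℕ) : ℕ :=
  ((Finset.Icc 1 N).filter fun r => Costly (req r) (E.cache r)).card
  + α * ∑ t ∈ Finset.Icc 1 N,
      (if E.newPhase t then (E.cache t).ncard else chgSize (E.chg t))

theorem RTree.Subforest.union {V : Type} {T : RTree V} {A B : Set V}
    (hA : T.Subforest A) (hB : T.Subforest B) : T.Subforest (A ∪ B) := by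
  rintro v (hv | hv)
  · exact (hA v hv).trans Set.subset_union_left
  · exact (hB v hv).trans Set.subset_union_right

theorem RTree.Subforest.inter {V : Type} {T : RTree V} {A B : Set V}
    (hA : T.Subforest A) (hB : T.Subforest B) : T.Subforest (A ∩ B) :=
  fun v hv => Set.subset_inter (hA v hv.1) (hB v hv.2)

theorem RTree.Valid.nonempty {V : Type} {T : RTree V} {C X : Set V}
    (h : T.Valid C X) : X.Nonempty :=
  h.elim And.left And.left

/-- After fetching `X`, a valid changeset either extends `X` to a larger valid changeset
for the old cache, or its part outside `X` was already valid (or is empty). -/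
theorem RTree.Valid.of_union {V : Type} {T : RTree V} {C X Y : Set V}
    (hC : T.Subforest C) (hX : T.ValidPos C X) (hY : T.Valid (C ∪ X) Y) :
    (Disjoint X Y ∧ T.Valid C (X ∪ Y)) ∨ ((Y \ X).Nonempty → T.Valid C (Y \ X)) := by
  obtain ⟨hne, hXC, -⟩ := hX
  rcases hY with ⟨-, hYC, hYF⟩ | ⟨-, hYC, hYF⟩
  · refine .inl ⟨?_, .inl ⟨hne.inl, ?_, by rwa [← Set.union_assoc]⟩⟩
    · rw [Set.disjoint_left]
      intro v hv hv'
      exact (Set.eq_empty_iff_forall_notMem.mp hYC v) ⟨hv', .inr hv⟩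
    · ext v
      have h1 := Set.ext_iff.mp hXC v
      have h2 := Set.ext_iff.mp hYC v
      simp only [Set.mem_inter_iff, Set.mem_union, Set.mem_empty_iff_false] at *
      tauto
  · refine .inr fun h => .inr ⟨h, ?_, ?_⟩
    · rintro v ⟨hv, hvX⟩
      exact (hYC hv).resolve_right hvX
    · convert hC.inter hYF using 1
      ext v
      have h1 := Set.ext_iff.mp hXC v
      simp only [Set.mem_inter_iff, Set.mem_union, Set.mem_sdiff, Set.mem_empty_iff_false] at *
      tauto

/-- After evicting `X`, a valid changeset either extends `X` to a larger valid changeset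
for the old cache, or its part outside `X` was already valid (or is empty). -/
theorem RTree.Valid.of_diff {V : Type} {T : RTree V} {C X Y : Set V}
    (hC : T.Subforest C) (hX : T.ValidNeg C X) (hY : T.Valid (C \ X) Y) :
    (Disjoint X Y ∧ T.Valid C (X ∪ Y)) ∨ ((Y \ X).Nonempty → T.Valid C (Y \ X)) := by
  obtain ⟨hne, hXC, -⟩ := hX
  rcases hY with ⟨-, hYC, hYF⟩ | ⟨-, hYC, hYF⟩
  · refine .inr fun h => .inl ⟨h, ?_, ?_⟩
    · ext v
      have h2 := Set.ext_iff.mp hYC v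
      simp only [Set.mem_inter_iff, Set.mem_sdiff, Set.mem_empty_iff_false] at *
      tauto
    · convert hC.union hYF using 1
      ext v
      have h1 := @hXC v
      simp only [Set.mem_union, Set.mem_sdiff] at *
      tauto
  · refine .inl ⟨?_, .inr ⟨hne.inl, ?_, by rwa [← Set.sdiff_sdiff]⟩⟩
    · rw [Set.disjoint_left]
      exact fun v hv hv' => (hYC hv').2 hv
    · exact Set.union_subset hXC fun v hv => (hYC hv).1

theorem cntSum_union {V : Type} [Fintype V] (f : V → ℕ) {A B : Set V} (h : Disjoint A B) :
    cntSum f (A ∪ B) = cntSum f A + cntSum f B := by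
  simp only [cntSum, Set.indicator_union_of_disjoint h, Finset.sum_add_distrib]

namespace TCPhase

variable {V : Type} [Fintype V] [DecidableEq V]
  {T : RTree V} {α : ℕ} {req : ℕ → Request V}

theorem cntSum_cnt_succ_of_notMem (E : TCPhase T α req) {t : ℕ} {A : Set V}
    (h : (req (t + 1)).1 ∉ A) : cntSum (E.cnt (t + 1)) A = cntSum (E.cntPost t) A := by
  refine Finset.sum_congr rfl fun v _ => ?_
  by_cases hv : v ∈ A
  · have hne : (req (t + 1)).1 ≠ v := fun e => h (e ▸ hv)
    simp [hv, E.cnt_rec, cntPost, hne]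
  · simp [hv]

theorem cntSum_cnt_succ_le (E : TCPhase T α req) (t : ℕ) (A : Set V) :
    cntSum (E.cnt (t + 1)) A ≤ cntSum (E.cntPost t) A + 1 := by
  calc cntSum (E.cnt (t + 1)) A
      ≤ ∑ v, (A.indicator (E.cntPost t) v + if (req (t + 1)).1 = v then 1 else 0) := by
        refine Finset.sum_le_sum fun v _ => ?_
        by_cases hv : v ∈ A
        · simp only [hv, Set.indicator_of_mem, E.cnt_rec, cntPost]
          gcongr
          split_ifs <;> simp_all
        · simp [hv]
    _ = cntSum (E.cntPost t) A + 1 := by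
        simp [Finset.sum_add_distrib, cntSum]

theorem cntSum_cntPost_of_none (E : TCPhase T α req) {t : ℕ} (h : E.chg t = none)
    (A : Set V) : cntSum (E.cntPost t) A = cntSum (E.cnt t) A := by
  simp [cntSum, cntPost, h, Set.indicator]

theorem cntSum_cntPost_of_some (E : TCPhase T α req) {t : ℕ} {X : Set V}
    (h : E.chg t = some X) (A : Set V) :
    cntSum (E.cntPost t) A = cntSum (E.cnt t) (A \ X) := by
  refine Finset.sum_congr rfl fun v _ => ?_
  by_cases hv : v ∈ A <;> by_cases hX : v ∈ X <;> simp [hv, hX, h, cntPost]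

theorem chg_zero (E : TCPhase T α req) (hα : 1 ≤ α) : E.chg 0 = none := by
  by_contra hne
  obtain ⟨X, hX⟩ := Option.ne_none_iff_exists'.mp hne
  obtain ⟨hv, hs, -⟩ := E.step_some 0 X hX
  have h0 : cntSum (E.cnt 0) X = 0 := by simp [cntSum, E.cnt_zero, Set.indicator]
  have hpos : 0 < X.ncard * α :=
    Nat.mul_pos ((Set.ncard_pos (Set.toFinite X)).mpr hv.nonempty) hα
  omega

theorem valid_succ (E : TCPhase T α req) {t : ℕ} {X Y : Set V} (hX : E.chg t = some X)
    (hY : T.Valid (E.cache (t + 1)) Y) :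
    (Disjoint X Y ∧ T.Valid (E.cache t) (X ∪ Y)) ∨
      ((Y \ X).Nonempty → T.Valid (E.cache t) (Y \ X)) := by
  obtain ⟨hv, -, -, hc⟩ := E.step_some t X hX
  rw [hc] at hY
  split_ifs at hY with hp
  · exact RTree.Valid.of_union (E.cache_subforest t) hp hY
  · exact RTree.Valid.of_diff (E.cache_subforest t) (hv.resolve_left hp) hY

theorem cntSum_cnt_succ_le_of_unsaturated (E : TCPhase T α req) {t : ℕ}
    (ih : ∀ Y, T.Valid (E.cache (t + 1)) Y → cntSum (E.cntPost t) Y < Y.ncard * α)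
    {Y : Set V} (hY : T.Valid (E.cache (t + 1)) Y) :
    cntSum (E.cnt (t + 1)) Y ≤ Y.ncard * α :=
  (E.cntSum_cnt_succ_le t Y).trans (ih Y hY)

theorem req_mem_of_unsaturated (E : TCPhase T α req) {t : ℕ}
    (ih : ∀ Y, T.Valid (E.cache (t + 1)) Y → cntSum (E.cntPost t) Y < Y.ncard * α)
    {X : Set V} (hX : E.chg (t + 1) = some X) : (req (t + 1)).1 ∈ X := by
  by_contra hn
  obtain ⟨hv, hs, -⟩ := E.step_some _ X hX
  have h1 := ih X hv
  rw [← E.cntSum_cnt_succ_of_notMem hn] at h1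
  omega

theorem cntSum_eq_of_unsaturated (E : TCPhase T α req) {t : ℕ}
    (ih : ∀ Y, T.Valid (E.cache (t + 1)) Y → cntSum (E.cntPost t) Y < Y.ncard * α)
    {X : Set V} (hX : E.chg (t + 1) = some X) :
    cntSum (E.cnt (t + 1)) X = X.ncard * α := by
  obtain ⟨hv, hs, -⟩ := E.step_some _ X hX
  exact le_antisymm (E.cntSum_cnt_succ_le_of_unsaturated ih hv) hs

/-- Right after the decision at any time, no valid changeset is saturated. -/
theorem cntSum_cntPost_lt (E : TCPhase T α req) (hα : 1 ≤ α) (t : ℕ) :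
    ∀ Y, T.Valid (E.cache (t + 1)) Y → cntSum (E.cntPost t) Y < Y.ncard * α := by
  have of_none : ∀ t, E.chg t = none →
      ∀ Y, T.Valid (E.cache (t + 1)) Y → cntSum (E.cntPost t) Y < Y.ncard * α := by
    intro t h Y hY
    obtain ⟨hc, hs⟩ := E.step_none t h
    rw [E.cntSum_cntPost_of_none h]
    exact hs Y (hc ▸ hY)
  induction t with
  | zero => exact of_none 0 (E.chg_zero hα)
  | succ t ih =>
    intro Y hY
    rcases hX : E.chg (t + 1) with _ | X
    · exact of_none _ hX Y hY
    rw [E.cntSum_cntPost_of_some hX]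
    have hreq := E.req_mem_of_unsaturated ih hX
    have heq := E.cntSum_eq_of_unsaturated ih hX
    obtain ⟨-, -, hmax, -⟩ := E.step_some _ X hX
    rcases E.valid_succ hX hY with ⟨hd, hv⟩ | hv
    · have hss : X ⊂ X ∪ Y := by
        refine Set.ssubset_iff_subset_ne.mpr ⟨Set.subset_union_left, fun e => ?_⟩
        obtain ⟨y, hy⟩ := hY.nonempty
        exact Set.disjoint_left.mp hd (e ▸ Or.inr hy) hy
      have h1 := hmax _ hv hss
      rw [cntSum_union _ hd, heq, Set.ncard_union_eq hd, add_mul] at h1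
      rw [hd.symm.sdiff_eq_left]
      omega
    · have hnotMem : (req (t + 1)).1 ∉ Y \ X := fun h => h.2 hreq
      rcases (Y \ X).eq_empty_or_nonempty with h0 | hne
      · rw [h0]
        have hpos : 0 < Y.ncard * α :=
          Nat.mul_pos ((Set.ncard_pos (Set.toFinite Y)).mpr hY.nonempty) hα
        simpa [cntSum] using hpos
      · calc cntSum (E.cnt (t + 1)) (Y \ X)
            = cntSum (E.cntPost t) (Y \ X) := E.cntSum_cnt_succ_of_notMem hnotMem
          _ < (Y \ X).ncard * α := ih _ (hv hne)
          _ ≤ Y.ncard * α :=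
            Nat.mul_le_mul_right α (Set.ncard_le_ncard Set.sdiff_subset (Set.toFinite Y))

end TCPhase

/-- at any time `t > begin(P) = 0` of a phase of `TC`, every valid
changeset `X'` for `C_t` satisfies `cnt_t(X') ≤ |X'|·α`; moreover, if `TC` applies a
changeset `X` at time `t`, then (1) `X` contains the node requested at round `t`,
(2) `cnt_t(X) = |X|·α`, and (3) `cnt_t(Y) < |Y|·α` for every valid changeset `Y` for
`C_{t+1}` (counters taken right after the application of `X`). -/
theorem tc_applied_changeset_properties {V : Type} [Fintype V] [DecidableEq V]
    {T : RTree V} {α : ℕ} {req : ℕ → Request V}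
    (E : TCPhase T α req) (hα : 1 ≤ α) (t : ℕ) (ht : 1 ≤ t) :
    (∀ X', T.Valid (E.cache t) X' → cntSum (E.cnt t) X' ≤ X'.ncard * α) ∧
    ∀ X, E.chg t = some X →
      (req t).1 ∈ X ∧
      cntSum (E.cnt t) X = X.ncard * α ∧
      ∀ Y, T.Valid (E.cache (t + 1)) Y → cntSum (E.cntPost t) Y < Y.ncard * α := by
  obtain ⟨t, rfl⟩ := Nat.exists_eq_add_of_le' ht
  have ih := E.cntSum_cntPost_lt hα t
  exact ⟨fun _ hX' => E.cntSum_cnt_succ_le_of_unsaturated ih hX',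
    fun _ hX => ⟨E.req_mem_of_unsaturated ih hX, E.cntSum_eq_of_unsaturated ih hX,
      E.cntSum_cntPost_lt hα (t + 1)⟩⟩
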